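/- arXiv:2008.09525 — 3 statements merged into one kernel-verified Lean document; each statement's English description precedes it below -/
import Mathlib

section
/- Let A be a regular Hopf coquasigroup over a field k with a faithful left integral φ, and let ξ ∈ A be a left cointegral, i.e. a nonzero element with aξ = ε(a)ξ for all a ∈ A. Then φ(ξ) ≠ 0. -/
open TensorProduct

/-- A regular Hopf coquasigroup over a field `k`: a unital associative `k`-algebra `A`
with a (not necessarily coassociative) coproduct `comul : A →ₐ[k] A ⊗[k] A`, a counit
`counit : A →ₐ[k] k`, and a bijective antipode `antipode : A ≃ₗ[k] A` which is
antimultiplicative, anticomultiplicative, and satisfies the quasigroup antipode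
identities. -/
structure RegularHopfCoquasigroup (k A : Type*) [Field k] [Ring A] [Algebra k A] where
  comul : A →ₐ[k] A ⊗[k] A
  counit : A →ₐ[k] k
  antipode : A ≃ₗ[k] A
  /-- `(ε ⊗ id) ∘ Δ = id` -/
  counit_comul_left : ∀ a : A,
    (TensorProduct.lid k A) ((LinearMap.rTensor A counit.toLinearMap) (comul a)) = a
  /-- `(id ⊗ ε) ∘ Δ = id` -/
  counit_comul_right : ∀ a : A,
    (TensorProduct.rid k A) ((LinearMap.lTensor A counit.toLinearMap) (comul a)) = a
  /-- `S(ab) = S(b)S(a)` -/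
  antipode_mul : ∀ a b : A, antipode (a * b) = antipode b * antipode a
  /-- `S(1) = 1` -/
  antipode_one : antipode (1 : A) = 1
  /-- `Δ ∘ S = (S ⊗ S) ∘ flip ∘ Δ` -/
  antipode_comul : ∀ a : A,
    comul (antipode a) =
      (TensorProduct.map antipode.toLinearMap antipode.toLinearMap)
        ((TensorProduct.comm k A A) (comul a))
  /-- `S(a₍₁₎)a₍₂₎₍₁₎ ⊗ a₍₂₎₍₂₎ = 1 ⊗ a` -/
  quasi₁ : ∀ a : A,
    (LinearMap.rTensor A (LinearMap.mul' k A))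
      ((TensorProduct.assoc k A A A).symm
        ((LinearMap.rTensor (A ⊗[k] A) antipode.toLinearMap)
          ((LinearMap.lTensor A comul.toLinearMap) (comul a)))) = (1 : A) ⊗ₜ[k] a
  /-- `a₍₁₎S(a₍₂₎₍₁₎) ⊗ a₍₂₎₍₂₎ = 1 ⊗ a` -/
  quasi₂ : ∀ a : A,
    (LinearMap.rTensor A (LinearMap.mul' k A))
      ((TensorProduct.assoc k A A A).symm
        ((LinearMap.lTensor A (LinearMap.rTensor A antipode.toLinearMap))
          ((LinearMap.lTensor A comul.toLinearMap) (comul a)))) = (1 : A) ⊗ₜ[k] a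
  /-- `a₍₁₎₍₁₎ ⊗ S(a₍₁₎₍₂₎)a₍₂₎ = a ⊗ 1` -/
  quasi₃ : ∀ a : A,
    (LinearMap.lTensor A (LinearMap.mul' k A))
      ((TensorProduct.assoc k A A A)
        ((LinearMap.rTensor A (LinearMap.lTensor A antipode.toLinearMap))
          ((LinearMap.rTensor A comul.toLinearMap) (comul a)))) = a ⊗ₜ[k] (1 : A)
  /-- `a₍₁₎₍₁₎ ⊗ a₍₁₎₍₂₎S(a₍₂₎) = a ⊗ 1` -/
  quasi₄ : ∀ a : A,
    (LinearMap.lTensor A (LinearMap.mul' k A))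
      ((TensorProduct.assoc k A A A)
        ((LinearMap.lTensor (A ⊗[k] A) antipode.toLinearMap)
          ((LinearMap.rTensor A comul.toLinearMap) (comul a)))) = a ⊗ₜ[k] (1 : A)

variable {k A : Type*} [Field k] [Ring A] [Algebra k A]

/-- `(id ⊗ f)` on `A ⊗[k] A`, composed with `A ⊗ k ≅ A`; so `idT f (a ⊗ b) = f b • a`,
i.e. in Sweedler notation `idT f (Δ a) = a₍₁₎ f(a₍₂₎)`. -/
noncomputable def idT (f : A →ₗ[k] k) : A ⊗[k] A →ₗ[k] A :=
  (TensorProduct.rid k A).toLinearMap ∘ₗ LinearMap.lTensor A f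

/-- `(f ⊗ id)` on `A ⊗[k] A`, composed with `k ⊗ A ≅ A`; so `Tid f (a ⊗ b) = f a • b`,
i.e. in Sweedler notation `Tid f (Δ a) = f(a₍₁₎) a₍₂₎`. -/
noncomputable def Tid (f : A →ₗ[k] k) : A ⊗[k] A →ₗ[k] A :=
  (TensorProduct.lid k A).toLinearMap ∘ₗ LinearMap.rTensor A f

/-- A linear functional `f` on `A` is faithful if `f(a·) = 0` implies `a = 0` and
`f(·a) = 0` implies `a = 0`. -/
def Faithful (f : A →ₗ[k] k) : Prop :=
  (∀ a : A, (∀ b : A, f (a * b) = 0) → a = 0) ∧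
  (∀ a : A, (∀ b : A, f (b * a) = 0) → a = 0)

/-- A left integral: a nonzero functional `φ` with `a₍₁₎ φ(a₍₂₎) = φ(a)·1`. -/
def IsLeftIntegral (H : RegularHopfCoquasigroup k A) (φ : A →ₗ[k] k) : Prop :=
  φ ≠ 0 ∧ ∀ a : A, idT φ (H.comul a) = φ a • (1 : A)

/-- A right integral: a nonzero functional `ψ` with `ψ(a₍₁₎) a₍₂₎ = ψ(a)·1`. -/
def IsRightIntegral (H : RegularHopfCoquasigroup k A) (ψ : A →ₗ[k] k) : Prop :=
  ψ ≠ 0 ∧ ∀ a : A, Tid ψ (H.comul a) = ψ a • (1 : A)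


/-- if `ξ` is a left cointegral (`aξ = ε(a)ξ`, `ξ ≠ 0`) and `φ` a faithful
left integral, then `φ(ξ) ≠ 0`. -/
theorem stmt_17 (k A : Type*) [Field k] [Ring A] [Algebra k A]
    (H : RegularHopfCoquasigroup k A) (φ : A →ₗ[k] k)
    (hφ : IsLeftIntegral H φ) (hf : Faithful φ)
    (ξ : A) (hξ0 : ξ ≠ 0) (hξ : ∀ a : A, a * ξ = H.counit a • ξ) :
    φ ξ ≠ 0 := by
  exact fun h => hξ0 (hf.2 ξ fun b => by rw [hξ, map_smul, h, smul_zero])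
end

section
/- Let A be a regular Hopf coquasigroup over a field k with a faithful left integral φ, and let Â = {φ(·a) : a ∈ A} ⊆ A*, where φ(·a) denotes the functional x ↦ φ(xa). For linear functionals w, w' on A define the convolution product (w*w')(x) = w(x₍₁₎)w'(x₍₂₎). Then: (i) for every w ∈ Â and a ∈ A one has w * φ(·a) = φ(·b) where b = w(S⁻¹(a₍₁₎))·a₍₂₎ (summation implicit); in particular Â is closed under convolution; (ii) if moreover A has a left cointegral ξ (a nonzero element with xξ = ε(x)ξ for all x), then ε = φ(ξ)⁻¹·φ(·ξ), so the counit ε belongs to Â and is a two-sided unit for convolution on Â. -/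
open TensorProduct

variable {k A : Type*} [Field k] [Ring A] [Algebra k A]

/-- Convolution product of linear functionals, dual to the coproduct:
`(w * w')(x) = w(x₍₁₎) w'(x₍₂₎)`. -/
noncomputable def conv (H : RegularHopfCoquasigroup k A) (w w' : A →ₗ[k] k) :
    A →ₗ[k] k :=
  (TensorProduct.lid k k).toLinearMap ∘ₗ (TensorProduct.map w w') ∘ₗ H.comul.toLinearMap

/-- The functional `φ(·a) : x ↦ φ(x a)`. -/
noncomputable def dualFun (φ : A →ₗ[k] k) (a : A) : A →ₗ[k] k :=
  φ ∘ₗ LinearMap.mulRight k a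

/-- `a₍₂₎₍₁₎S⁻¹(a₍₁₎) ⊗ a₍₂₎₍₂₎ = 1 ⊗ a`, the form of `quasi₂` involving the inverse antipode. -/
theorem RegularHopfCoquasigroup.mul_antipode_symm_comul
    (H : RegularHopfCoquasigroup k A) (a : A) :
    TensorProduct.lift
      ((LinearMap.rTensorHom A ∘ₗ (LinearMap.mul k A).flip) ∘ₗ H.antipode.symm.toLinearMap)
      (LinearMap.lTensor A H.comul.toLinearMap (H.comul a)) = (1 : A) ⊗ₜ[k] a := by
  have antipode_symm_mul (p q : A) :
      H.antipode.symm (p * H.antipode q) = q * H.antipode.symm p := by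
    apply H.antipode.injective
    simp [H.antipode_mul]
  have antipode_symm_one : H.antipode.symm (1 : A) = 1 := by
    rw [LinearEquiv.symm_apply_eq, H.antipode_one]
  have factor : TensorProduct.lift
      ((LinearMap.rTensorHom A ∘ₗ (LinearMap.mul k A).flip) ∘ₗ H.antipode.symm.toLinearMap) =
      LinearMap.rTensor A H.antipode.symm.toLinearMap ∘ₗ
        LinearMap.rTensor A (LinearMap.mul' k A) ∘ₗ
        (TensorProduct.assoc k A A A).symm.toLinearMap ∘ₗ
        LinearMap.lTensor A (LinearMap.rTensor A H.antipode.toLinearMap) := by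
    ext p q r
    simp [antipode_symm_mul]
  rw [factor]
  simp only [LinearMap.comp_apply, LinearEquiv.coe_coe]
  rw [H.quasi₂]
  simp [antipode_symm_one]

theorem idT_mul_rTensor_mul_flip (φ : A →ₗ[k] k) (s t : A ⊗[k] A) (c : A) :
    idT φ (s * LinearMap.rTensor A ((LinearMap.mul k A).flip c) t) = idT φ (s * t) * c := by
  induction t with
  | zero => simp
  | add t₁ t₂ h₁ h₂ => simp only [map_add, mul_add, add_mul, h₁, h₂]
  | tmul p q =>
    induction s with
    | zero => simp
    | add s₁ s₂ h₁ h₂ => simp only [map_add, add_mul, h₁, h₂]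
    | tmul u v => simp [idT, mul_assoc]

/-- Strong left invariance: `x₍₁₎ φ(x₍₂₎a) = S⁻¹(a₍₁₎) φ(xa₍₂₎)`. -/
theorem IsLeftIntegral.idT_comul_mul {H : RegularHopfCoquasigroup k A} {φ : A →ₗ[k] k}
    (hφ : IsLeftIntegral H φ) (x a : A) :
    idT φ (H.comul x * (1 : A) ⊗ₜ[k] a) =
      idT (φ ∘ₗ LinearMap.mulLeft k x)
        (LinearMap.rTensor A H.antipode.symm.toLinearMap (H.comul a)) := by
  rw [← H.mul_antipode_symm_comul a]
  generalize H.comul a = t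
  induction t with
  | zero => simp
  | add t₁ t₂ h₁ h₂ => simp only [map_add, mul_add, h₁, h₂]
  | tmul p q =>
    have h := idT_mul_rTensor_mul_flip φ (H.comul x) (H.comul q) (H.antipode.symm p)
    rw [← map_mul, hφ.2 (x * q)] at h
    simpa [idT] using h

theorem conv_dualFun_apply (H : RegularHopfCoquasigroup k A) (φ w : A →ₗ[k] k) (a x : A) :
    conv H w (dualFun φ a) x = w (idT φ (H.comul x * (1 : A) ⊗ₜ[k] a)) := by
  simp only [conv, LinearMap.comp_apply, AlgHom.toLinearMap_apply]
  generalize H.comul x = t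
  induction t with
  | zero => simp
  | add t₁ t₂ h₁ h₂ => simp only [map_add, add_mul, h₁, h₂]
  | tmul p q => simp [idT, dualFun, mul_comm]

theorem IsLeftIntegral.conv_dualFun {H : RegularHopfCoquasigroup k A} {φ : A →ₗ[k] k}
    (hφ : IsLeftIntegral H φ) (w : A →ₗ[k] k) (a : A) :
    conv H w (dualFun φ a) =
      dualFun φ (Tid (w ∘ₗ H.antipode.symm.toLinearMap) (H.comul a)) := by
  ext x
  rw [conv_dualFun_apply, hφ.idT_comul_mul]
  generalize H.comul a = t
  induction t with
  | zero => simp [dualFun]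
  | add t₁ t₂ h₁ h₂ =>
    simp only [map_add, h₁, h₂]
    simp [dualFun, mul_add]
  | tmul p q => simp [idT, Tid, dualFun, mul_comm]

theorem counit_conv (H : RegularHopfCoquasigroup k A) (w : A →ₗ[k] k) :
    conv H H.counit.toLinearMap w = w := by
  ext x
  conv_rhs => rw [← H.counit_comul_left x]
  simp only [conv, LinearMap.comp_apply, AlgHom.toLinearMap_apply]
  generalize H.comul x = t
  induction t with
  | zero => simp
  | add t₁ t₂ h₁ h₂ => simp only [map_add, h₁, h₂]
  | tmul p q => simp

theorem conv_counit (H : RegularHopfCoquasigroup k A) (w : A →ₗ[k] k) :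
    conv H w H.counit.toLinearMap = w := by
  ext x
  conv_rhs => rw [← H.counit_comul_right x]
  simp only [conv, LinearMap.comp_apply, AlgHom.toLinearMap_apply]
  generalize H.comul x = t
  induction t with
  | zero => simp
  | add t₁ t₂ h₁ h₂ => simp only [map_add, h₁, h₂]
  | tmul p q => simp [mul_comm]

theorem Faithful.counit_eq_smul_dualFun {H : RegularHopfCoquasigroup k A} {φ : A →ₗ[k] k}
    (hf : Faithful φ) {ξ : A} (hξ : ξ ≠ 0) (h : ∀ x : A, x * ξ = H.counit x • ξ) :
    H.counit.toLinearMap = (φ ξ)⁻¹ • dualFun φ ξ := by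
  have hφξ : φ ξ ≠ 0 := fun h₀ => hξ (hf.2 ξ fun b => by simp [h, h₀])
  ext x
  simp [dualFun, h, mul_comm, hφξ]

/-- (i) `w * φ(·a) = φ(·b)` with `b = w(S⁻¹(a₍₁₎)) a₍₂₎`, so the space
`Â = {φ(·a)}` is closed under convolution; (ii) if a left cointegral `ξ` exists then
`ε = φ(ξ)⁻¹ φ(·ξ)`, so `ε ∈ Â` and `ε` is a two-sided convolution unit on `Â`. -/
theorem stmt_18 (k A : Type*) [Field k] [Ring A] [Algebra k A]
    (H : RegularHopfCoquasigroup k A) (φ : A →ₗ[k] k)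
    (hφ : IsLeftIntegral H φ) (hf : Faithful φ) :
    (∀ w : A →ₗ[k] k, w ∈ Set.range (dualFun φ) → ∀ a : A,
      conv H w (dualFun φ a) =
        dualFun φ (Tid (w ∘ₗ H.antipode.symm.toLinearMap) (H.comul a))) ∧
    (∀ w w' : A →ₗ[k] k, w ∈ Set.range (dualFun φ) → w' ∈ Set.range (dualFun φ) →
      conv H w w' ∈ Set.range (dualFun φ)) ∧
    (∀ ξ : A, ξ ≠ 0 → (∀ x : A, x * ξ = H.counit x • ξ) →
      (H.counit.toLinearMap = (φ ξ)⁻¹ • dualFun φ ξ ∧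
       H.counit.toLinearMap ∈ Set.range (dualFun φ) ∧
       ∀ w : A →ₗ[k] k, w ∈ Set.range (dualFun φ) →
         conv H H.counit.toLinearMap w = w ∧ conv H w H.counit.toLinearMap = w)) := by
  refine ⟨fun w _ a => hφ.conv_dualFun w a, ?_, fun ξ hξ h => ?_⟩
  · rintro w _ - ⟨a, rfl⟩
    exact ⟨_, (hφ.conv_dualFun w a).symm⟩
  · have hε := hf.counit_eq_smul_dualFun hξ h
    refine ⟨hε, ⟨(φ ξ)⁻¹ • ξ, ?_⟩, fun w _ => ⟨counit_conv H w, conv_counit H w⟩⟩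
    rw [hε]
    ext x
    simp [dualFun]
end

section
/- Let A be a regular Hopf coquasigroup over a field k with a faithful left integral φ and a left cointegral ξ (so A is of discrete type). Then for every a ∈ A the functional φ(·a) is 'comultiplicative through Â' in the following explicit sense: for all x, y ∈ A, φ(x·y·a) = φ(ξ)⁻¹ · Σ φ(x·S⁻¹(ξ₍₁₎)·a)·φ(y·ξ₍₂₎), where Δ(ξ) = Σ ξ₍₁₎ ⊗ ξ₍₂₎; consequently the dual coproduct of φ(·a), given by (x,y) ↦ φ(xya), lies in Â ⊗ Â for Â = {φ(·b) : b ∈ A}. -/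
open TensorProduct

variable {k A : Type*} [Field k] [Ring A] [Algebra k A]

@[simp]
theorem idT_tmul (f : A →ₗ[k] k) (u v : A) : idT f (u ⊗ₜ[k] v) = f v • u := by
  simp [idT]

theorem idT_tmul_one_mul (f : A →ₗ[k] k) (u : A) (T : A ⊗[k] A) :
    idT f ((u ⊗ₜ[k] (1 : A)) * T) = u * idT f T := by
  induction T with
  | zero => simp
  | tmul p q => simp
  | add p q hp hq => simp only [mul_add, map_add, hp, hq]

theorem idT_comp_mulLeft (f : A →ₗ[k] k) (v : A) (T : A ⊗[k] A) :
    idT (f ∘ₗ LinearMap.mulLeft k v) T = idT f (((1 : A) ⊗ₜ[k] v) * T) := by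
  induction T with
  | zero => simp
  | tmul p q => simp
  | add p q hp hq => simp only [mul_add, map_add, hp, hq]

theorem rTensor_mul'_assoc_symm_tmul (u : A) (T : A ⊗[k] A) :
    LinearMap.rTensor A (LinearMap.mul' k A) ((TensorProduct.assoc k A A A).symm (u ⊗ₜ[k] T)) =
      (u ⊗ₜ[k] (1 : A)) * T := by
  induction T with
  | zero => simp
  | tmul p q => simp
  | add p q hp hq => simp only [mul_add, map_add, tmul_add, hp, hq]

/-- Strong left invariance: `b₍₁₎ φ(y b₍₂₎) = S(y₍₁₎) φ(y₍₂₎ b)`. -/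
theorem IsLeftIntegral.strong_invariance {H : RegularHopfCoquasigroup k A} {φ : A →ₗ[k] k}
    (hφ : IsLeftIntegral H φ) (y b : A) :
    idT (φ ∘ₗ LinearMap.mulLeft k y) (H.comul b) =
      H.antipode (idT (φ ∘ₗ LinearMap.mulRight k b) (H.comul y)) := by
  rw [idT_comp_mulLeft, ← H.quasi₁ y]
  induction H.comul y with
  | zero => simp
  | tmul p q =>
    rw [LinearMap.lTensor_tmul, LinearMap.rTensor_tmul, rTensor_mul'_assoc_symm_tmul, mul_assoc,
      AlgHom.toLinearMap_apply, ← map_mul, idT_tmul_one_mul, hφ.2]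
    simp
  | add p q hp hq => simp only [add_mul, map_add, hp, hq]

/-- If `ξ` is a left cointegral, then `S⁻¹(ξ₍₁₎) φ(y ξ₍₂₎) = φ(ξ) y`. -/
theorem IsLeftIntegral.antipode_symm_idT_cointegral {H : RegularHopfCoquasigroup k A}
    {φ : A →ₗ[k] k} (hφ : IsLeftIntegral H φ) {ξ : A}
    (hξ : ∀ x : A, x * ξ = H.counit x • ξ) (y : A) :
    H.antipode.symm (idT (φ ∘ₗ LinearMap.mulLeft k y) (H.comul ξ)) = φ ξ • y := by
  have h : φ ∘ₗ LinearMap.mulRight k ξ = φ ξ • H.counit.toLinearMap := by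
    ext x
    simp [hξ, mul_comm]
  have hy : idT H.counit.toLinearMap (H.comul y) = y := H.counit_comul_right y
  rw [hφ.strong_invariance, LinearEquiv.symm_apply_apply, h]
  calc idT (φ ξ • H.counit.toLinearMap) (H.comul y)
      = φ ξ • idT H.counit.toLinearMap (H.comul y) := by simp [idT, LinearMap.lTensor_smul]
    _ = φ ξ • y := by rw [hy]

/-- A faithful functional does not vanish on a left cointegral. -/
theorem Faithful.apply_cointegral_ne_zero {H : RegularHopfCoquasigroup k A} {φ : A →ₗ[k] k}
    (hf : Faithful φ) {ξ : A} (hξ0 : ξ ≠ 0) (hξ : ∀ x : A, x * ξ = H.counit x • ξ) :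
    φ ξ ≠ 0 := fun h => hξ0 (hf.2 ξ fun b => by simp [hξ, h])

theorem lid_map_eq_apply_idT (f g : A →ₗ[k] k) (T : A ⊗[k] A) :
    TensorProduct.lid k k (TensorProduct.map f g T) = f (idT g T) := by
  induction T with
  | zero => simp
  | tmul p q => simp [mul_comm]
  | add p q hp hq => simp only [map_add, hp, hq]

theorem exists_lid_map_eq_sum (T : A ⊗[k] A) :
    ∃ (n : ℕ) (p q : Fin n → A), ∀ f g : A →ₗ[k] k,
      TensorProduct.lid k k (TensorProduct.map f g T) = ∑ i, f (p i) * g (q i) := by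
  obtain ⟨n, p, q, rfl⟩ := TensorProduct.exists_sum_tmul_eq T
  exact ⟨n, p, q, fun f g => by simp⟩

/-- for `A` of discrete type with cointegral `ξ`, for every `a`:
`φ(xya) = φ(ξ)⁻¹ Σ φ(x S⁻¹(ξ₍₁₎) a) φ(y ξ₍₂₎)` for all `x, y`; consequently the dual
coproduct `(x, y) ↦ φ(xya)` of `φ(·a)` lies in `Â ⊗ Â`, i.e. it is a finite sum
`Σᵢ φ(· bᵢ) ⊗ φ(· cᵢ)` of elements of `Â`. -/
theorem stmt_19 (k A : Type*) [Field k] [Ring A] [Algebra k A]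
    (H : RegularHopfCoquasigroup k A) (φ : A →ₗ[k] k)
    (hφ : IsLeftIntegral H φ) (hf : Faithful φ)
    (ξ : A) (hξ0 : ξ ≠ 0) (hξ : ∀ x : A, x * ξ = H.counit x • ξ) (a : A) :
    (∀ x y : A,
      φ (x * y * a) = (φ ξ)⁻¹ *
        (TensorProduct.lid k k)
          ((TensorProduct.map
              (φ ∘ₗ (LinearMap.mulRight k a) ∘ₗ (LinearMap.mulLeft k x) ∘ₗ
                H.antipode.symm.toLinearMap)
              (φ ∘ₗ LinearMap.mulLeft k y))
            (H.comul ξ))) ∧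
    ∃ (n : ℕ) (b c : Fin n → A), ∀ x y : A,
      φ (x * y * a) = ∑ i, φ (x * b i) * φ (y * c i) := by
  have hne : φ ξ ≠ 0 := hf.apply_cointegral_ne_zero hξ0 hξ
  have key : ∀ x y : A, φ (x * y * a) = (φ ξ)⁻¹ *
      (TensorProduct.lid k k)
        ((TensorProduct.map
            (φ ∘ₗ (LinearMap.mulRight k a) ∘ₗ (LinearMap.mulLeft k x) ∘ₗ
              H.antipode.symm.toLinearMap)
            (φ ∘ₗ LinearMap.mulLeft k y))
          (H.comul ξ)) := by
    intro x y
    rw [lid_map_eq_apply_idT]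
    simp [hφ.antipode_symm_idT_cointegral hξ, hne]
  refine ⟨key, ?_⟩
  obtain ⟨n, p, q, hpq⟩ := exists_lid_map_eq_sum (k := k) (H.comul ξ)
  refine ⟨n, fun i => (φ ξ)⁻¹ • (H.antipode.symm (p i) * a), q, fun x y => ?_⟩
  rw [key, hpq, Finset.mul_sum]
  simp [mul_assoc]
end
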